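/- Let λ₁, λ₂, λ₃ be real numbers and let Φ be the unital qubit map on 2×2 complex matrices determined by Φ(I) = I, Φ(σ_x) = λ₁σ_x, Φ(σ_y) = λ₂σ_y, Φ(σ_z) = λ₃σ_z (where σ_x, σ_y, σ_z are the Pauli matrices), and assume Φ is CPTP. Then (Φ ⊗ id₂)(ρ) is classical-quantum with respect to the first subsystem for every state ρ on ℂ² ⊗ ℂ² if and only if at least two of λ₁, λ₂, λ₃ are zero. (Unital qubit discord-breaking channels acting on subsystem A, Fig. 2.) -/

import Mathlib

open Matrix
open scoped Kronecker ComplexOrder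

noncomputable section

/-- A state: positive semidefinite matrix with unit trace. -/
def IsState {ι : Type} [Fintype ι] (ρ : Matrix ι ι ℂ) : Prop :=
  ρ.PosSemidef ∧ ρ.trace = 1

/-- The rank-one matrix `|ψ⟩⟨ψ| = ψ ψ†`. -/
def outer {d : ℕ} (ψ : Fin d → ℂ) : Matrix (Fin d) (Fin d) ℂ :=
  Matrix.of fun i j => ψ i * star (ψ j)

/-- A bipartite state (on `ℂ^{dA} ⊗ ℂ^{dB}`, Kronecker-product convention) is
classical-quantum with respect to subsystem `A` if it is a convex combination
`∑ k, p k • |ψ k⟩⟨ψ k| ⊗ σB k` with `{ψ k}` orthonormal in `ℂ^{dA}` and `σB k` states. -/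
def IsCQ {dA dB : ℕ} (ρ : Matrix (Fin dA × Fin dB) (Fin dA × Fin dB) ℂ) : Prop :=
  ∃ (n : ℕ) (ψ : Fin n → Fin dA → ℂ) (p : Fin n → ℝ)
    (σB : Fin n → Matrix (Fin dB) (Fin dB) ℂ),
      (∀ k l, star (ψ k) ⬝ᵥ ψ l = if k = l then 1 else 0) ∧
      (∀ k, 0 ≤ p k) ∧ (∑ k, p k = 1) ∧ (∀ k, IsState (σB k)) ∧
      ρ = ∑ k, (p k : ℂ) • (outer (ψ k) ⊗ₖ σB k)

/-- The `(a,b)` block (a matrix on the second factor) of a matrix on `Fin m × ι`. -/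
def blockA {m : ℕ} {ι : Type} (a b : Fin m) :
    Matrix (Fin m × ι) (Fin m × ι) ℂ →ₗ[ℂ] Matrix ι ι ℂ where
  toFun M := Matrix.of fun i j => M (a, i) (b, j)
  map_add' _ _ := rfl
  map_smul' _ _ := rfl

/-- The `(i,j)` slice (a matrix on the first factor) of a matrix on `Fin m × Fin d`. -/
def blockB {m d : ℕ} (i j : Fin d) :
    Matrix (Fin m × Fin d) (Fin m × Fin d) ℂ →ₗ[ℂ] Matrix (Fin m) (Fin m) ℂ where
  toFun M := Matrix.of fun a b => M (a, i) (b, j)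
  map_add' _ _ := rfl
  map_smul' _ _ := rfl

/-- `id_m ⊗ Φ`: the extension of `Φ` (acting on the second factor) by the identity
on the first factor.  On Kronecker products, `(id_m ⊗ Φ)(Y ⊗ₖ X) = Y ⊗ₖ Φ X`. -/
def idTensor {ι : Type} (m : ℕ) (Φ : Matrix ι ι ℂ →ₗ[ℂ] Matrix ι ι ℂ) :
    Matrix (Fin m × ι) (Fin m × ι) ℂ →ₗ[ℂ] Matrix (Fin m × ι) (Fin m × ι) ℂ where
  toFun M := Matrix.of fun p q => Φ (blockA p.1 q.1 M) p.2 q.2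
  map_add' M N := by
    ext ⟨a, i⟩ ⟨b, j⟩
    simp [Matrix.add_apply]
  map_smul' c M := by
    ext ⟨a, i⟩ ⟨b, j⟩
    simp [Matrix.smul_apply]

/-- `Φ ⊗ id_m`: the extension of `Φ` (acting on the first factor) by the identity
on the second factor.  On Kronecker products, `(Φ ⊗ id_m)(X ⊗ₖ Y) = Φ X ⊗ₖ Y`. -/
def tensorId {d : ℕ} (Φ : Matrix (Fin d) (Fin d) ℂ →ₗ[ℂ] Matrix (Fin d) (Fin d) ℂ)
    (m : ℕ) :
    Matrix (Fin d × Fin m) (Fin d × Fin m) ℂ →ₗ[ℂ]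
      Matrix (Fin d × Fin m) (Fin d × Fin m) ℂ where
  toFun M := Matrix.of fun p q => Φ (blockB p.2 q.2 M) p.1 q.1
  map_add' M N := by
    ext ⟨a, i⟩ ⟨b, j⟩
    simp [Matrix.add_apply]
  map_smul' c M := by
    ext ⟨a, i⟩ ⟨b, j⟩
    simp [Matrix.smul_apply]

/-- CPTP: trace preserving and completely positive (every extension `id_k ⊗ Φ`
maps positive semidefinite matrices to positive semidefinite matrices). -/
def IsCPTP {ι : Type} [Fintype ι] (Φ : Matrix ι ι ℂ →ₗ[ℂ] Matrix ι ι ℂ) : Prop :=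
  (∀ X, (Φ X).trace = X.trace) ∧
  ∀ k : ℕ, ∀ M : Matrix (Fin k × ι) (Fin k × ι) ℂ,
    M.PosSemidef → (idTensor k Φ M).PosSemidef

/-- Partial trace over the second (B) factor: `tr_B(X ⊗ₖ Y) = tr(Y) • X`. -/
def ptraceB {dA dB : ℕ} (M : Matrix (Fin dA × Fin dB) (Fin dA × Fin dB) ℂ) :
    Matrix (Fin dA) (Fin dA) ℂ :=
  Matrix.of fun a b => ∑ i, M (a, i) (b, i)

/-- The point channel with fixed state `σ`: `X ↦ tr(X) • σ`. -/
def pointChannel {d : ℕ} (σ : Matrix (Fin d) (Fin d) ℂ) :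
    Matrix (Fin d) (Fin d) ℂ →ₗ[ℂ] Matrix (Fin d) (Fin d) ℂ where
  toFun X := X.trace • σ
  map_add' X Y := by simp [Matrix.trace_add, add_smul]
  map_smul' c X := by simp [Matrix.trace_smul, smul_smul]

/-- A quantum-classical channel: `Φ(X) = ∑ k, tr(F k * X) • |ψ k⟩⟨ψ k|` for an
orthonormal family `{ψ k}` and a POVM `{F k}`. -/
def IsQCChannel {d : ℕ} (Φ : Matrix (Fin d) (Fin d) ℂ →ₗ[ℂ] Matrix (Fin d) (Fin d) ℂ) :
    Prop :=
  ∃ (n : ℕ) (ψ : Fin n → Fin d → ℂ) (F : Fin n → Matrix (Fin d) (Fin d) ℂ),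
    (∀ k l, star (ψ k) ⬝ᵥ ψ l = if k = l then 1 else 0) ∧
    (∀ k, (F k).PosSemidef) ∧ (∑ k, F k = 1) ∧
    (∀ X, Φ X = ∑ k, (F k * X).trace • outer (ψ k))

/-- The Pauli matrix `σ_x`. -/
def pauliX : Matrix (Fin 2) (Fin 2) ℂ := !![0, 1; 1, 0]

/-- The Pauli matrix `σ_y`. -/
def pauliY : Matrix (Fin 2) (Fin 2) ℂ := !![0, -Complex.I; Complex.I, 0]

/-- The Pauli matrix `σ_z`. -/
def pauliZ : Matrix (Fin 2) (Fin 2) ℂ := !![1, 0; 0, -1]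

/-- The slices of a classical-quantum matrix on the first factor commute. -/
theorem IsCQ.commute_blockB {dA dB : ℕ} {ρ : Matrix (Fin dA × Fin dB) (Fin dA × Fin dB) ℂ}
    (h : IsCQ ρ) (i j i' j' : Fin dB) :
    Commute (blockB i j ρ) (blockB i' j' ρ) := by
  obtain ⟨n, ψ, p, σB, hψ, -, -, -, rfl⟩ := h
  have houter : ∀ k l, outer (ψ k) * outer (ψ l) = if k = l then outer (ψ k) else 0 := by
    intro k l
    have h1 : outer (ψ k) * outer (ψ l) = (star (ψ k) ⬝ᵥ ψ l) • vecMulVec (ψ k) (star (ψ l)) :=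
      vecMulVec_mul_vecMulVec (ψ k) (star (ψ k)) (ψ l) (star (ψ l)) |>.trans (by
        ext a b
        simp [vecMulVec_apply]
        ring)
    rw [h1, hψ]
    split_ifs with hkl
    · subst hkl
      rw [one_smul]
      rfl
    · rw [zero_smul]
  have hblock : ∀ i j, blockB i j (∑ k, (p k : ℂ) • (outer (ψ k) ⊗ₖ σB k)) =
      ∑ k, ((p k : ℂ) * σB k i j) • outer (ψ k) := by
    intro i j
    ext a b
    rw [Matrix.sum_apply]
    change (∑ k, (p k : ℂ) • (outer (ψ k) ⊗ₖ σB k)) (a, i) (b, j) = _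
    rw [Matrix.sum_apply]
    refine Finset.sum_congr rfl fun k _ => ?_
    simp [kroneckerMap_apply]
    ring
  rw [hblock, hblock]
  refine Commute.sum_left _ _ _ fun k _ => Commute.sum_right _ _ _ fun l _ => ?_
  refine Commute.smul_left (Commute.smul_right ?_ _) _
  rw [commute_iff_eq, houter, houter]
  by_cases hkl : k = l
  · simp [hkl]
  · simp [hkl, Ne.symm hkl]

/-- A state whose slices on the first factor are all diagonal in one orthonormal family is
classical-quantum. -/
theorem IsState.isCQ_of_blockB_eq {dA dB n : ℕ}
    {ρ : Matrix (Fin dA × Fin dB) (Fin dA × Fin dB) ℂ} (hρ : IsState ρ)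
    (ψ : Fin n → Fin dA → ℂ) (hψ : ∀ k l, star (ψ k) ⬝ᵥ ψ l = if k = l then 1 else 0)
    (C : Fin n → Matrix (Fin dB) (Fin dB) ℂ)
    (hC : ∀ i j, blockB i j ρ = ∑ k, C k i j • outer (ψ k)) : IsCQ ρ := by
  have hent : ∀ a b i j, ρ (a, i) (b, j) = ∑ k, C k i j * (ψ k a * star (ψ k b)) := by
    intro a b i j
    have h1 : blockB i j ρ a b = (∑ k, C k i j • outer (ψ k)) a b := by rw [hC]
    rw [Matrix.sum_apply] at h1
    exact h1
  have hψ' : ∀ k l, ∑ a, star (ψ k a) * ψ l a = if k = l then 1 else 0 := hψ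
  have hsum : ρ = ∑ k, outer (ψ k) ⊗ₖ C k := by
    ext ⟨a, i⟩ ⟨b, j⟩
    rw [hent, Matrix.sum_apply]
    refine Finset.sum_congr rfl fun k _ => ?_
    simp [kroneckerMap_apply, outer]
    ring
  have hpsd : ∀ k, (C k).PosSemidef := by
    intro k
    let V : Matrix (Fin dA × Fin dB) (Fin dB) ℂ :=
      Matrix.of fun q j => ψ k q.1 * (1 : Matrix (Fin dB) (Fin dB) ℂ) q.2 j
    have hV : C k = Vᴴ * ρ * V := by
      have hmul : ∀ l, Vᴴ * (outer (ψ l) ⊗ₖ C l) * V = if k = l then C k else 0 := by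
        intro l
        have hl : Vᴴ * (outer (ψ l) ⊗ₖ C l) * V =
            ((∑ a, star (ψ k a) * ψ l a) * (∑ b, star (ψ l b) * ψ k b)) • C l := by
          ext i j
          simp only [Matrix.mul_apply, V, Fintype.sum_prod_type, conjTranspose_apply, of_apply,
            kroneckerMap_apply, outer, Matrix.one_apply, Matrix.smul_apply, smul_eq_mul]
          simp [Finset.sum_mul, Finset.mul_sum, apply_ite (starRingEnd ℂ), ite_mul]
          refine Finset.sum_congr rfl fun b _ => Finset.sum_congr rfl fun a _ => ?_
          ring
        rw [hl, hψ', hψ']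
        by_cases hkl : k = l
        · subst hkl; simp
        · simp [hkl]
      rw [hsum, Matrix.mul_sum, Matrix.sum_mul]
      simp [hmul]
    rw [hV]
    exact hρ.1.conjTranspose_mul_mul_same V
  have htr : ∀ k, (((C k).trace.re : ℝ) : ℂ) = (C k).trace := by
    intro k
    exact (Complex.eq_re_of_ofReal_le (r := 0) (by simpa using (hpsd k).trace_nonneg)).symm
  have hdB : 0 < dB := by
    rcases Nat.eq_zero_or_pos dB with h0 | h0
    · subst h0
      have := hρ.2
      simp [Matrix.trace] at this
    · exact h0
  obtain ⟨τ, hτ⟩ : ∃ τ : Matrix (Fin dB) (Fin dB) ℂ, IsState τ := by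
    refine ⟨Matrix.diagonal (Pi.single ⟨0, hdB⟩ 1), PosSemidef.diagonal ?_, ?_⟩
    · exact Pi.single_nonneg.2 zero_le_one
    · simp [Matrix.trace_diagonal]
  refine ⟨n, ψ, fun k => (C k).trace.re,
    fun k => if (C k).trace = 0 then τ else ((C k).trace)⁻¹ • C k, hψ, ?_, ?_, ?_, ?_⟩
  · intro k
    exact (Complex.le_def.1 (hpsd k).trace_nonneg).1
  · have h1 := hρ.2
    have htro : ∀ k, (outer (ψ k)).trace = 1 := by
      intro k
      have := hψ' k k
      simp only [if_true] at this
      rw [← this]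
      simp [Matrix.trace, outer, mul_comm]
    rw [hsum, Matrix.trace_sum] at h1
    simp only [Matrix.trace_kronecker, htro, one_mul] at h1
    rw [← Complex.re_sum, h1, Complex.one_re]
  · intro k
    by_cases h0 : (C k).trace = 0
    · simpa [h0] using hτ
    · simp only [h0, if_false]
      refine ⟨(hpsd k).smul (inv_nonneg.2 (hpsd k).trace_nonneg), ?_⟩
      rw [Matrix.trace_smul, smul_eq_mul, inv_mul_cancel₀ h0]
  · rw [hsum]
    refine Finset.sum_congr rfl fun k _ => ?_
    rw [htr]
    by_cases h0 : (C k).trace = 0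
    · simp [(hpsd k).trace_eq_zero_iff.1 h0]
    · simp only [h0, if_false]
      rw [Matrix.kronecker_smul, smul_smul, mul_inv_cancel₀ h0, one_smul]

/-- A channel acting on the first factor maps states to states. -/
theorem IsCPTP.isState_tensorId {d m : ℕ}
    {Φ : Matrix (Fin d) (Fin d) ℂ →ₗ[ℂ] Matrix (Fin d) (Fin d) ℂ} (hΦ : IsCPTP Φ)
    {ρ : Matrix (Fin d × Fin m) (Fin d × Fin m) ℂ} (hρ : IsState ρ) :
    IsState (tensorId Φ m ρ) := by
  constructor
  · exact (hΦ.2 m _ (hρ.1.submatrix Prod.swap)).submatrix Prod.swap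
  · have htr : ∀ M : Matrix (Fin d × Fin m) (Fin d × Fin m) ℂ,
        M.trace = ∑ i, (blockB i i M).trace := by
      intro M
      simp only [Matrix.trace, Matrix.diag_apply, Fintype.sum_prod_type]
      rw [Finset.sum_comm]
      rfl
    have hb : ∀ i, blockB i i (tensorId Φ m ρ) = Φ (blockB i i ρ) := fun i => rfl
    rw [← hρ.2, htr, htr ρ]
    simp only [hb, hΦ.1]

/-- A qubit channel whose range is spanned by the two projections onto an orthonormal basis is
discord-breaking. -/
theorem IsCPTP.isCQ_tensorId_of_range
    {Φ : Matrix (Fin 2) (Fin 2) ℂ →ₗ[ℂ] Matrix (Fin 2) (Fin 2) ℂ} (hΦ : IsCPTP Φ)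
    (ψ : Fin 2 → Fin 2 → ℂ) (hψ : ∀ k l, star (ψ k) ⬝ᵥ ψ l = if k = l then 1 else 0)
    {S : Matrix (Fin 2) (Fin 2) ℂ} (hone : outer (ψ 0) + outer (ψ 1) = 1)
    (hS : outer (ψ 0) - outer (ψ 1) = S)
    (hrange : ∀ X, ∃ t u : ℂ, Φ X = t • 1 + u • S)
    {m : ℕ} {ρ : Matrix (Fin 2 × Fin m) (Fin 2 × Fin m) ℂ} (hρ : IsState ρ) :
    IsCQ (tensorId Φ m ρ) := by
  choose t u htu using hrange
  refine (hΦ.isState_tensorId hρ).isCQ_of_blockB_eq ψ hψ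
    ![Matrix.of fun i j => t (blockB i j ρ) + u (blockB i j ρ),
      Matrix.of fun i j => t (blockB i j ρ) - u (blockB i j ρ)] fun i j => ?_
  have hb : blockB i j (tensorId Φ m ρ) = Φ (blockB i j ρ) := rfl
  rw [hb, htu, ← hone, ← hS]
  simp only [Fin.sum_univ_two, Matrix.cons_val_zero, Matrix.cons_val_one, of_apply]
  module

/-- Pauli expansion of a `2 × 2` matrix. -/
theorem eq_pauli_combination (X : Matrix (Fin 2) (Fin 2) ℂ) :
    X = ((X 0 0 + X 1 1) / 2) • (1 : Matrix (Fin 2) (Fin 2) ℂ) +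
      ((X 0 1 + X 1 0) / 2) • pauliX +
      (Complex.I * (X 0 1 - X 1 0) / 2) • pauliY + ((X 0 0 - X 1 1) / 2) • pauliZ := by
  ext i j
  fin_cases i <;> fin_cases j <;> simp [pauliX, pauliY, pauliZ] <;> ring_nf <;>
    simp only [Complex.I_sq] <;> ring

/-- The maximally entangled two-qubit state `½ ∑ |ii⟩⟨jj|`. -/
def bellState : Matrix (Fin 2 × Fin 2) (Fin 2 × Fin 2) ℂ :=
  (1 / 2 : ℂ) • vecMulVec (fun q => if q.1 = q.2 then 1 else 0)
    (star fun q => if q.1 = q.2 then 1 else 0)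

theorem isState_bellState : IsState bellState := by
  constructor
  · exact (posSemidef_vecMulVec_self_star _).smul (one_div_nonneg.2 zero_le_two)
  · simp [bellState, Matrix.trace, Fintype.sum_prod_type, vecMulVec_apply]

theorem blockB_bellState (i j : Fin 2) :
    blockB i j bellState = (1 / 2 : ℂ) • Matrix.single i j 1 := by
  ext a b
  fin_cases i <;> fin_cases j <;> fin_cases a <;> fin_cases b <;>
    simp [bellState, blockB, vecMulVec_apply]

/-- A linear map on qubit matrices that makes the maximally entangled state classical-quantum has
commutative range. -/
theorem commute_of_isCQ_tensorId_bellState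
    {Φ : Matrix (Fin 2) (Fin 2) ℂ →ₗ[ℂ] Matrix (Fin 2) (Fin 2) ℂ}
    (h : IsCQ (tensorId Φ 2 bellState)) (X Y : Matrix (Fin 2) (Fin 2) ℂ) :
    Commute (Φ X) (Φ Y) := by
  have hsingle : ∀ i j i' j' : Fin 2,
      Commute (Φ (Matrix.single i j 1)) (Φ (Matrix.single i' j' 1)) := by
    intro i j i' j'
    have hb : ∀ i j, Φ (Matrix.single i j 1) =
        (2 : ℂ) • blockB i j (tensorId Φ 2 bellState) := by
      intro i j
      have : blockB i j (tensorId Φ 2 bellState) = Φ (blockB i j bellState) := rfl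
      rw [this, blockB_bellState, map_smul, smul_smul]
      norm_num
    rw [hb, hb]
    exact ((h.commute_blockB i j i' j').smul_left _).smul_right _
  have hexp : ∀ X, Φ X = ∑ i, ∑ j, X i j • Φ (Matrix.single i j 1) := by
    intro X
    conv_lhs => rw [Matrix.matrix_eq_sum_single X]
    simp only [map_sum, ← map_smul, Matrix.smul_single, smul_eq_mul, mul_one]
  rw [hexp X, hexp Y]
  exact Commute.sum_left _ _ _ fun i _ => Commute.sum_left _ _ _ fun j _ =>
    Commute.sum_right _ _ _ fun i' _ => Commute.sum_right _ _ _ fun j' _ =>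
      ((hsingle i j i' j').smul_left _).smul_right _

/-- A complex square root of one half that is fixed by conjugation. -/
theorem exists_conj_eq_self_mul_self_eq_half :
    ∃ s : ℂ, (starRingEnd ℂ) s = s ∧ s * s = 1 / 2 := by
  refine ⟨(Real.sqrt (1 / 2) : ℝ), Complex.conj_ofReal _, ?_⟩
  rw [← Complex.ofReal_mul, Real.mul_self_sqrt (by norm_num)]
  norm_num

/-- Fig. 2, channel on subsystem A: a unital qubit channel with
Pauli damping parameters `(λ₁, λ₂, λ₃)` acting on subsystem `A` is
discord-breaking iff at least two of the parameters vanish. -/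
theorem stmt_16 (l₁ l₂ l₃ : ℝ)
    (Φ : Matrix (Fin 2) (Fin 2) ℂ →ₗ[ℂ] Matrix (Fin 2) (Fin 2) ℂ)
    (hI : Φ 1 = 1)
    (hx : Φ pauliX = (l₁ : ℂ) • pauliX)
    (hy : Φ pauliY = (l₂ : ℂ) • pauliY)
    (hz : Φ pauliZ = (l₃ : ℂ) • pauliZ)
    (hΦ : IsCPTP Φ) :
    (∀ ρ : Matrix (Fin 2 × Fin 2) (Fin 2 × Fin 2) ℂ, IsState ρ →
      IsCQ (tensorId Φ 2 ρ)) ↔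
    ((l₁ = 0 ∧ l₂ = 0) ∨ (l₁ = 0 ∧ l₃ = 0) ∨ (l₂ = 0 ∧ l₃ = 0)) := by
  have hexp : ∀ X, Φ X = ((X 0 0 + X 1 1) / 2) • (1 : Matrix (Fin 2) (Fin 2) ℂ) +
      ((X 0 1 + X 1 0) / 2) • (l₁ : ℂ) • pauliX +
      (Complex.I * (X 0 1 - X 1 0) / 2) • (l₂ : ℂ) • pauliY +
      ((X 0 0 - X 1 1) / 2) • (l₃ : ℂ) • pauliZ := by
    intro X
    conv_lhs => rw [eq_pauli_combination X]
    simp only [map_add, map_smul, hI, hx, hy, hz]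
  constructor
  · intro h
    have hcomm := commute_of_isCQ_tensorId_bellState (h _ isState_bellState)
    have h12 : l₁ = 0 ∨ l₂ = 0 := by
      have := congrFun (congrFun (hcomm pauliX pauliY).eq 0) 0
      rw [hx, hy] at this
      have h2 : (l₁ : ℂ) * l₂ = 0 := by
        simp [pauliX, pauliY, Matrix.mul_apply] at this
        linear_combination (-Complex.I / 2) * this + (l₁ : ℂ) * l₂ * Complex.I_sq
      exact_mod_cast mul_eq_zero.1 h2
    have h13 : l₁ = 0 ∨ l₃ = 0 := by
      have := congrFun (congrFun (hcomm pauliX pauliZ).eq 0) 1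
      rw [hx, hz] at this
      have h2 : (l₁ : ℂ) * l₃ = 0 := by
        simp only [Matrix.smul_mul, Matrix.mul_smul, Matrix.smul_apply] at this
        simp [pauliX, pauliZ] at this
        linear_combination (-1 / 2) * this
      exact_mod_cast mul_eq_zero.1 h2
    have h23 : l₂ = 0 ∨ l₃ = 0 := by
      have := congrFun (congrFun (hcomm pauliY pauliZ).eq 0) 1
      rw [hy, hz] at this
      have h2 : (l₂ : ℂ) * l₃ = 0 := by
        simp only [Matrix.smul_mul, Matrix.mul_smul, Matrix.smul_apply] at this
        simp [pauliY, pauliZ] at this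
        linear_combination (-Complex.I / 2) * this + (l₂ : ℂ) * l₃ * Complex.I_sq
      exact_mod_cast mul_eq_zero.1 h2
    tauto
  · obtain ⟨s, hs, hss⟩ := exists_conj_eq_self_mul_self_eq_half
    rintro (⟨rfl, rfl⟩ | ⟨rfl, rfl⟩ | ⟨rfl, rfl⟩) ρ hρ
    · refine hΦ.isCQ_tensorId_of_range ![![1, 0], ![0, 1]] ?_ (S := pauliZ) ?_ ?_ ?_ hρ
      · intro k l
        fin_cases k <;> fin_cases l <;> simp [dotProduct]
      · ext i j
        fin_cases i <;> fin_cases j <;> simp [outer]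
      · ext i j
        fin_cases i <;> fin_cases j <;> simp [outer, pauliZ]
      · intro X
        refine ⟨(X 0 0 + X 1 1) / 2, (X 0 0 - X 1 1) / 2 * l₃, (hexp X).trans ?_⟩
        simp only [Complex.ofReal_zero, zero_smul, smul_zero, add_zero, smul_smul]
    · refine hΦ.isCQ_tensorId_of_range ![![s, Complex.I * s], ![s, -Complex.I * s]] ?_
        (S := pauliY) ?_ ?_ ?_ hρ
      · intro k l
        fin_cases k <;> fin_cases l <;> simp [dotProduct, hs] <;>
          grind [Complex.I_mul_I]
      · ext i j
        fin_cases i <;> fin_cases j <;> simp [outer, hs] <;>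
          grind [Complex.I_mul_I]
      · ext i j
        fin_cases i <;> fin_cases j <;> simp [outer, pauliY, hs] <;>
          grind [Complex.I_mul_I]
      · intro X
        refine ⟨(X 0 0 + X 1 1) / 2, Complex.I * (X 0 1 - X 1 0) / 2 * l₂, (hexp X).trans ?_⟩
        simp only [Complex.ofReal_zero, zero_smul, smul_zero, add_zero, smul_smul]
    · refine hΦ.isCQ_tensorId_of_range ![![s, s], ![s, -s]] ?_ (S := pauliX) ?_ ?_ ?_ hρ
      · intro k l
        fin_cases k <;> fin_cases l <;> simp [dotProduct, hs] <;> grind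
      · ext i j
        fin_cases i <;> fin_cases j <;> simp [outer, hs] <;> grind
      · ext i j
        fin_cases i <;> fin_cases j <;> simp [outer, pauliX, hs] <;> grind
      · intro X
        refine ⟨(X 0 0 + X 1 1) / 2, (X 0 1 + X 1 0) / 2 * l₁, (hexp X).trans ?_⟩
        simp only [Complex.ofReal_zero, zero_smul, smul_zero, add_zero, smul_smul]
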